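/- (Theorem 1.) Let T ∈ ℕ with T ≥ 1, q : {1,…,T} → ℝ, and let 0 = x₁ < x₂ < ⋯ < x_n = 100 be finitely many points with values h₁,…,h_n ∈ ℝ. Let h̄ : [0,100] → ℝ be the piecewise-linear interpolant through the points (x_i, h_i), i.e., for x ∈ [x_i, x_{i+1}], h̄(x) = ((x_{i+1} − x)·h_i + (x − x_i)·h_{i+1})/(x_{i+1} − x_i). Then F⁽²⁾(x_i;q) ≤ h_i holds for every i ∈ {1,…,n} if and only if F⁽²⁾(x;q) ≤ h̄(x) holds for every x ∈ [0,100]. -/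

import Mathlib

/-- The second-order empirical cumulative distribution function of a quality
sequence `q` on `{1, …, T}`. -/
noncomputable def secondOrderECDF (T : ℕ) (q : ℕ → ℝ) (x : ℝ) : ℝ :=
  (1 / (T : ℝ)) * ∑ t ∈ Finset.Icc 1 T, max (x - q t) 0

/-- Theorem 1: let `0 = x₀ < x₁ < ⋯ < x_n = 100` with values
`h₀, …, h_n`, and let `h̄` be the piecewise-linear interpolant through the
points `(x i, h i)`.  Then `F⁽²⁾(x_i;q) ≤ h_i` for all `i` iff
`F⁽²⁾(x;q) ≤ h̄(x)` for all `x ∈ [0,100]`. -/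
theorem secondOrderECDF_constraint_iff_piecewise_linear
    (T : ℕ) (hT : 1 ≤ T) (q : ℕ → ℝ)
    (n : ℕ) (hn : 1 ≤ n) (xs h : Fin (n + 1) → ℝ)
    (hmono : StrictMono xs) (hx0 : xs 0 = 0) (hxn : xs (Fin.last n) = 100)
    (hbar : ℝ → ℝ)
    (hbar_interp : ∀ i : Fin n, ∀ x ∈ Set.Icc (xs i.castSucc) (xs i.succ),
      hbar x = ((xs i.succ - x) * h i.castSucc + (x - xs i.castSucc) * h i.succ) /
        (xs i.succ - xs i.castSucc)) :
    (∀ i : Fin (n + 1), secondOrderECDF T q (xs i) ≤ h i) ↔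
      (∀ x ∈ Set.Icc (0 : ℝ) 100, secondOrderECDF T q x ≤ hbar x) := by
  have hlt : ∀ i : Fin n, xs i.castSucc < xs i.succ := fun i => hmono i.castSucc_lt_succ
  have hnode : ∀ i : Fin (n + 1), hbar (xs i) = h i := by
    intro i
    refine Fin.cases ?_ (fun j => ?_) i
    · have h1 := hbar_interp ⟨0, hn⟩ (xs 0) ⟨le_rfl, (hlt ⟨0, hn⟩).le⟩
      have h2 := hlt ⟨0, hn⟩
      have h3 : (Fin.castSucc ⟨0, hn⟩ : Fin (n + 1)) = 0 := rfl
      rw [h3] at h1 h2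
      rw [h1, sub_self, zero_mul, add_zero]
      exact mul_div_cancel_left₀ _ (sub_pos.2 h2).ne'
    · have h1 := hbar_interp j (xs j.succ) ⟨(hlt j).le, le_rfl⟩
      rw [h1, sub_self, zero_mul, zero_add]
      exact mul_div_cancel_left₀ _ (sub_pos.2 (hlt j)).ne'
  have hconv : ∀ a b x : ℝ, a ≤ x → x ≤ b →
      secondOrderECDF T q x * (b - a) ≤
        (b - x) * secondOrderECDF T q a + (x - a) * secondOrderECDF T q b := by
    intro a b x hax hxb
    have hs : (∑ t ∈ Finset.Icc 1 T, max (x - q t) 0) * (b - a) ≤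
        (b - x) * (∑ t ∈ Finset.Icc 1 T, max (a - q t) 0) +
          (x - a) * (∑ t ∈ Finset.Icc 1 T, max (b - q t) 0) := by
      rw [Finset.sum_mul, Finset.mul_sum, Finset.mul_sum, ← Finset.sum_add_distrib]
      refine Finset.sum_le_sum fun t _ => ?_
      have hA1 := mul_le_mul_of_nonneg_left (le_max_left (a - q t) 0) (sub_nonneg.2 hxb)
      have hA2 := mul_le_mul_of_nonneg_left (le_max_right (a - q t) 0) (sub_nonneg.2 hxb)
      have hB1 := mul_le_mul_of_nonneg_left (le_max_left (b - q t) 0) (sub_nonneg.2 hax)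
      have hB2 := mul_le_mul_of_nonneg_left (le_max_right (b - q t) 0) (sub_nonneg.2 hax)
      rcases max_choice (x - q t) 0 with hm | hm <;> rw [hm] <;> nlinarith
    have hT0 : (0 : ℝ) ≤ 1 / (T : ℝ) := by positivity
    have := mul_le_mul_of_nonneg_left hs hT0
    unfold secondOrderECDF
    linarith
  constructor
  · intro H x hx
    have key : ∀ j : Fin (n + 1), ∀ y : ℝ, 0 ≤ y → y ≤ xs j →
        secondOrderECDF T q y ≤ hbar y := by
      intro j
      induction j using Fin.induction with
      | zero =>
        intro y h0 hy
        have : y = xs 0 := le_antisymm hy (hx0 ▸ h0)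
        rw [this, hnode]
        exact H 0
      | succ i ih =>
        intro y h0 hy
        rcases le_total y (xs i.castSucc) with hle | hle
        · exact ih y h0 hle
        · rw [hbar_interp i y ⟨hle, hy⟩, le_div_iff₀ (sub_pos.2 (hlt i))]
          refine (hconv _ _ y hle hy).trans ?_
          exact add_le_add (mul_le_mul_of_nonneg_left (H _) (sub_nonneg.2 hy))
            (mul_le_mul_of_nonneg_left (H _) (sub_nonneg.2 hle))
    exact key (Fin.last n) x hx.1 (hxn ▸ hx.2)
  · intro H i
    rw [← hnode i]
    refine H _ ⟨?_, ?_⟩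
    · rw [← hx0]
      exact hmono.monotone (Fin.zero_le i)
    · rw [← hxn]
      exact hmono.monotone (Fin.le_last i)
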